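/- The two-sided ideals of the algebra S_n commute: for all two-sided ideals I and J of S_n one has IJ = JI. -/

import Mathlib

set_option synthInstance.maxHeartbeats 1000000
set_option maxHeartbeats 1000000

open MvPolynomial

noncomputable section

/-- The polynomial algebra `P_n = K[x_1, …, x_n]`. -/
abbrev PolyAlg (K : Type u) [Field K] (n : ℕ) := MvPolynomial (Fin n) K

/-- `X_i` : multiplication by the variable `x_i`, as a `K`-linear endomorphism of `P_n`. -/
def Xop (K : Type u) [Field K] (n : ℕ) (i : Fin n) : Module.End K (PolyAlg K n) :=
  LinearMap.mulLeft K (X i)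

/-- `Y_i` : the left inverse of `X_i`, sending a monomial `x^α` to `x^{α - e_i}` if `α i ≥ 1`
and to `0` otherwise. -/
def Yop (K : Type u) [Field K] (n : ℕ) (i : Fin n) : Module.End K (PolyAlg K n) :=
  (basisMonomials (Fin n) K).constr K fun α =>
    if α i = 0 then 0 else monomial (α - Finsupp.single i 1) (1 : K)

/-- The algebra `S_n` of one-sided inverses of `P_n` : the subalgebra of `End_K(P_n)`
generated by `X_1, …, X_n, Y_1, …, Y_n`. -/
def SnAlg (K : Type u) [Field K] (n : ℕ) : Subalgebra K (Module.End K (PolyAlg K n)) :=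
  Algebra.adjoin K (Set.range (Xop K n) ∪ Set.range (Yop K n))

/-- `x_i` as an element of `S_n`. -/
def xS (K : Type u) [Field K] (n : ℕ) (i : Fin n) : SnAlg K n :=
  ⟨Xop K n i, Algebra.subset_adjoin (Set.mem_union_left _ ⟨i, rfl⟩)⟩

/-- `y_i` as an element of `S_n`. -/
def yS (K : Type u) [Field K] (n : ℕ) (i : Fin n) : SnAlg K n :=
  ⟨Yop K n i, Algebra.subset_adjoin (Set.mem_union_right _ ⟨i, rfl⟩)⟩

/-- The product `I*J` of two two-sided ideals: the two-sided ideal generated by all products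
`a * b` with `a ∈ I`, `b ∈ J`. -/
def tsiMul {R : Type*} [Ring R] (I J : TwoSidedIdeal R) : TwoSidedIdeal R :=
  TwoSidedIdeal.span {x | ∃ a ∈ I, ∃ b ∈ J, x = a * b}

/-- A two-sided ideal `P` of a ring is prime if it is proper and for all two-sided ideals
`I`, `J`, `I*J ⊆ P` implies `I ⊆ P` or `J ⊆ P`. -/
def tsiPrime {R : Type*} [Ring R] (P : TwoSidedIdeal R) : Prop :=
  P ≠ ⊤ ∧ ∀ I J : TwoSidedIdeal R, tsiMul I J ≤ P → I ≤ P ∨ J ≤ P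

/-- Families `x`, `y` satisfying the defining relations of the algebra of one-sided inverses. -/
structure OneSidedInverses {ι R : Type*} [Ring R] (x y : ι → R) : Prop where
  inv : ∀ i, y i * x i = 1
  comm_x : ∀ i j, Commute (x i) (x j)
  comm_y : ∀ i j, Commute (y i) (y j)
  comm_xy : ∀ i j, i ≠ j → Commute (x i) (y j)

namespace OneSidedInverses

variable {ι R : Type*} [Ring R] {x y : ι → R}

/-- The idempotent `1 - x_i y_i`. -/
def proj (x y : ι → R) (i : ι) : R := 1 - x i * y i

theorem proj_mul_x (h : OneSidedInverses x y) (i : ι) : proj x y i * x i = 0 := by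
  rw [proj, sub_mul, mul_assoc, h.inv, one_mul, mul_one, sub_self]

theorem y_mul_proj (h : OneSidedInverses x y) (i : ι) : y i * proj x y i = 0 := by
  rw [proj, mul_sub, ← mul_assoc, h.inv, one_mul, mul_one, sub_self]

theorem commute_proj_x (h : OneSidedInverses x y) {i j : ι} (hij : i ≠ j) :
    Commute (proj x y i) (x j) :=
  (Commute.one_left _).sub_left ((h.comm_x i j).mul_left (h.comm_xy j i hij.symm).symm)

theorem commute_proj_y (h : OneSidedInverses x y) {i j : ι} (hij : i ≠ j) :
    Commute (proj x y i) (y j) :=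
  (Commute.one_left _).sub_left ((h.comm_xy i j hij).mul_left (h.comm_y i j))

theorem commute_proj_proj (h : OneSidedInverses x y) {i j : ι} (hij : i ≠ j) :
    Commute (proj x y i) (proj x y j) :=
  (Commute.one_right _).sub_right ((h.commute_proj_x hij).mul_right (h.commute_proj_y hij))

/-- The product of the idempotents `1 - x_i y_i` for `i ∈ A`. -/
def projProd (h : OneSidedInverses x y) (A : Finset ι) : R :=
  A.noncommProd (proj x y) fun _ _ _ _ hij => h.commute_proj_proj hij

theorem projProd_empty (h : OneSidedInverses x y) : h.projProd ∅ = 1 :=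
  Finset.noncommProd_empty _ _

theorem projProd_insert [DecidableEq ι] (h : OneSidedInverses x y) {A : Finset ι} {j : ι} (hj : j ∉ A) :
    h.projProd (insert j A) = proj x y j * h.projProd A :=
  Finset.noncommProd_insert_of_notMem _ _ _ _ hj

theorem projProd_insert' [DecidableEq ι] (h : OneSidedInverses x y) {A : Finset ι} {j : ι} (hj : j ∉ A) :
    h.projProd (insert j A) = h.projProd A * proj x y j :=
  Finset.noncommProd_insert_of_notMem' _ _ _ _ hj

theorem commute_projProd_x (h : OneSidedInverses x y) {A : Finset ι} {j : ι} (hj : j ∉ A) :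
    Commute (h.projProd A) (x j) :=
  (Finset.noncommProd_commute _ _ _ _ fun _ hi =>
    (h.commute_proj_x (ne_of_mem_of_not_mem hi hj)).symm).symm

theorem commute_projProd_y (h : OneSidedInverses x y) {A : Finset ι} {j : ι} (hj : j ∉ A) :
    Commute (h.projProd A) (y j) :=
  (Finset.noncommProd_commute _ _ _ _ fun _ hi =>
    (h.commute_proj_y (ne_of_mem_of_not_mem hi hj)).symm).symm

theorem projProd_mul_x [DecidableEq ι] (h : OneSidedInverses x y) {A : Finset ι} {j : ι} (hj : j ∈ A) :
    h.projProd A * x j = 0 := by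
  rw [← Finset.insert_erase hj, h.projProd_insert' (Finset.notMem_erase j A), mul_assoc,
    h.proj_mul_x, mul_zero]

theorem y_mul_projProd [DecidableEq ι] (h : OneSidedInverses x y) {A : Finset ι} {j : ι} (hj : j ∈ A) :
    y j * h.projProd A = 0 := by
  rw [← Finset.insert_erase hj, h.projProd_insert (Finset.notMem_erase j A), ← mul_assoc,
    h.y_mul_proj, zero_mul]

theorem projProd_mul_self [DecidableEq ι] (h : OneSidedInverses x y) (A : Finset ι) :
    h.projProd A * h.projProd A = h.projProd A := by
  induction A using Finset.induction_on with
  | empty => simp [projProd_empty]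
  | insert j A hj ih =>
    nth_rewrite 2 [h.projProd_insert hj]
    rw [proj, sub_mul, mul_sub, one_mul, ← mul_assoc, ← mul_assoc,
      h.projProd_mul_x (Finset.mem_insert_self j A), zero_mul, zero_mul, sub_zero,
      h.projProd_insert hj, mul_assoc, ih]

/-- The submonoid generated by the `y_j` with `j ∉ A`. -/
def yMonoid (y : ι → R) (A : Finset ι) : Submonoid R := Submonoid.closure (y '' {j | j ∉ A})

theorem commute_projProd_yMonoid (h : OneSidedInverses x y) {A : Finset ι} {w : R}
    (hw : w ∈ yMonoid y A) : Commute (h.projProd A) w := by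
  induction hw using Submonoid.closure_induction with
  | mem _ hm => obtain ⟨j, hj, rfl⟩ := hm; exact h.commute_projProd_y hj
  | one => exact Commute.one_right _
  | mul _ _ _ _ h₁ h₂ => exact h₁.mul_right h₂

theorem commute_yMonoid (h : OneSidedInverses x y) {A : Finset ι} {v w : R}
    (hv : v ∈ yMonoid y A) (hw : w ∈ yMonoid y A) : Commute v w := by
  induction hv, hw using Submonoid.closure_induction₂ with
  | mem _ _ hv hw =>
    obtain ⟨i, -, rfl⟩ := hv
    obtain ⟨j, -, rfl⟩ := hw
    exact h.comm_y i j
  | one_left => exact Commute.one_left _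
  | one_right => exact Commute.one_right _
  | mul_left _ _ _ _ _ _ h₁ h₂ => exact h₁.mul_left h₂
  | mul_right _ _ _ _ _ _ h₁ h₂ => exact h₁.mul_right h₂

variable {K : Type*} [Field K] [Algebra K R]

theorem commute_span_yMonoid (h : OneSidedInverses x y) {A : Finset ι} {v w : R}
    (hv : v ∈ Submodule.span K (yMonoid y A : Set R))
    (hw : w ∈ Submodule.span K (yMonoid y A : Set R)) : Commute v w := by
  induction hv, hw using Submodule.span_induction₂ with
  | mem_mem _ _ hv hw => exact h.commute_yMonoid hv hw
  | zero_left => exact Commute.zero_left _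
  | zero_right => exact Commute.zero_right _
  | add_left _ _ _ _ _ _ h₁ h₂ => exact h₁.add_left h₂
  | add_right _ _ _ _ _ _ h₁ h₂ => exact h₁.add_right h₂
  | smul_left r _ _ _ _ h₁ => exact h₁.smul_left r
  | smul_right r _ _ _ _ h₁ => exact h₁.smul_right r

theorem commute_projProd_span_yMonoid (h : OneSidedInverses x y) {A : Finset ι} {w : R}
    (hw : w ∈ Submodule.span K (yMonoid y A : Set R)) : Commute (h.projProd A) w := by
  induction hw using Submodule.span_induction with
  | mem _ hw => exact h.commute_projProd_yMonoid hw
  | zero => exact Commute.zero_right _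
  | add _ _ _ _ h₁ h₂ => exact h₁.add_right h₂
  | smul r _ _ h₁ => exact h₁.smul_right r

theorem mul_mem_span_yMonoid {A : Finset ι} {v w : R} (hv : v ∈ yMonoid y A)
    (hw : w ∈ Submodule.span K (yMonoid y A : Set R)) :
    v * w ∈ Submodule.span K (yMonoid y A : Set R) := by
  induction hw using Submodule.span_induction with
  | mem _ hw => exact Submodule.subset_span (mul_mem hv hw)
  | zero => simp
  | add _ _ _ _ h₁ h₂ => rw [mul_add]; exact add_mem h₁ h₂
  | smul r _ _ h₁ => rw [mul_smul_comm]; exact Submodule.smul_mem _ r h₁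

/-- The set of products of a monomial in the `x_i` and a monomial in the `y_i`. -/
def normalMonomials (x y : ι → R) : Set R :=
  {r | ∃ u ∈ Submonoid.closure (Set.range x), ∃ v ∈ Submonoid.closure (Set.range y), r = u * v}

theorem y_mul_xMonoid (h : OneSidedInverses x y) (i : ι) {u : R}
    (hu : u ∈ Submonoid.closure (Set.range x)) :
    y i * u ∈ Submonoid.closure (Set.range x) ∨ y i * u = u * y i := by
  induction hu using Submonoid.closure_induction_left with
  | one => right; simp
  | mul_left _ hx u hu ih =>
    obtain ⟨j, rfl⟩ := hx
    by_cases hij : j = i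
    · subst hij
      left
      rwa [← mul_assoc, h.inv, one_mul]
    · rw [← mul_assoc, ← (h.comm_xy j i hij).eq, mul_assoc, mul_assoc]
      rcases ih with ih | ih
      · exact Or.inl (mul_mem (Submonoid.subset_closure ⟨j, rfl⟩) ih)
      · exact Or.inr (by rw [ih])

theorem mul_mem_span_normalMonomials (h : OneSidedInverses x y) {g : R}
    (hg : g ∈ Set.range x ∪ Set.range y) {t : R}
    (ht : t ∈ Submodule.span K (normalMonomials x y)) :
    g * t ∈ Submodule.span K (normalMonomials x y) := by
  induction ht using Submodule.span_induction with
  | mem _ ht =>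
    obtain ⟨u, hu, v, hv, rfl⟩ := ht
    apply Submodule.subset_span
    rcases hg with hg | ⟨i, rfl⟩
    · exact ⟨g * u, mul_mem (Submonoid.subset_closure hg) hu, v, hv, (mul_assoc _ _ _).symm⟩
    · rcases h.y_mul_xMonoid i hu with h₁ | h₁
      · exact ⟨y i * u, h₁, v, hv, (mul_assoc _ _ _).symm⟩
      · exact ⟨u, hu, y i * v, mul_mem (Submonoid.subset_closure ⟨i, rfl⟩) hv, by
          rw [← mul_assoc, h₁, mul_assoc]⟩
  | zero => simp
  | add _ _ _ _ h₁ h₂ => rw [mul_add]; exact add_mem h₁ h₂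
  | smul r _ _ h₁ => rw [mul_smul_comm]; exact Submodule.smul_mem _ r h₁

theorem mem_span_normalMonomials (h : OneSidedInverses x y)
    (gen : Algebra.adjoin K (Set.range x ∪ Set.range y) = ⊤) (r : R) :
    r ∈ Submodule.span K (normalMonomials x y) := by
  suffices H : ∀ t ∈ Submodule.span K (normalMonomials x y),
      r * t ∈ Submodule.span K (normalMonomials x y) by
    simpa using H 1 (Submodule.subset_span ⟨1, one_mem _, 1, one_mem _, by simp⟩)
  have hr : r ∈ Algebra.adjoin K (Set.range x ∪ Set.range y) := gen ▸ Algebra.mem_top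
  induction hr using Algebra.adjoin_induction with
  | mem g hg => exact fun t ht => h.mul_mem_span_normalMonomials hg ht
  | algebraMap c =>
    intro t ht
    rw [← Algebra.smul_def]
    exact Submodule.smul_mem _ c ht
  | add a b _ _ ha hb =>
    intro t ht
    rw [add_mul]
    exact add_mem (ha t ht) (hb t ht)
  | mul a b _ _ ha hb =>
    intro t ht
    rw [mul_assoc]
    exact ha _ (hb t ht)

theorem projProd_mul_xMonoid [DecidableEq ι] (h : OneSidedInverses x y) (A : Finset ι) {u : R}
    (hu : u ∈ Submonoid.closure (Set.range x)) :
    h.projProd A * u = 0 ∨ Commute (h.projProd A) u ∧ ∃ w ∈ yMonoid y A, w * u = 1 := by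
  induction hu using Submonoid.closure_induction_left with
  | one => exact Or.inr ⟨Commute.one_right _, 1, one_mem _, mul_one _⟩
  | mul_left _ hx u hu ih =>
    obtain ⟨j, rfl⟩ := hx
    by_cases hj : j ∈ A
    · left
      rw [← mul_assoc, h.projProd_mul_x hj, zero_mul]
    · have hc := h.commute_projProd_x hj
      rcases ih with ih | ⟨ih, w, hw, hwu⟩
      · left
        rw [← mul_assoc, hc.eq, mul_assoc, ih, mul_zero]
      · refine Or.inr ⟨hc.mul_right ih, w * y j,
          mul_mem hw (Submonoid.subset_closure ⟨j, hj, rfl⟩), ?_⟩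
        rw [mul_assoc, ← mul_assoc (y j), h.inv, one_mul, hwu]

theorem yMonoid_mul_projProd [DecidableEq ι] (h : OneSidedInverses x y) (A : Finset ι) {v : R}
    (hv : v ∈ Submonoid.closure (Set.range y)) :
    v * h.projProd A = 0 ∨ v ∈ yMonoid y A := by
  induction hv using Submonoid.closure_induction_right with
  | one => exact Or.inr (one_mem _)
  | mul_right v hv _ hy ih =>
    obtain ⟨j, rfl⟩ := hy
    by_cases hj : j ∈ A
    · left
      rw [mul_assoc, h.y_mul_projProd hj, mul_zero]
    · rcases ih with ih | ih
      · left
        rw [mul_assoc, ← (h.commute_projProd_y hj).eq, ← mul_assoc, ih, zero_mul]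
      · exact Or.inr (mul_mem ih (Submonoid.subset_closure ⟨j, hj, rfl⟩))

theorem exists_mul_corner [DecidableEq ι] (h : OneSidedInverses x y)
    (gen : Algebra.adjoin K (Set.range x ∪ Set.range y) = ⊤) (A : Finset ι) (r : R) :
    ∃ w ∈ yMonoid y A, ∃ q ∈ Submodule.span K (yMonoid y A : Set R),
      w * (h.projProd A * r * h.projProd A) = q * h.projProd A := by
  induction h.mem_span_normalMonomials gen r using Submodule.span_induction with
  | mem _ hr =>
    obtain ⟨u, hu, v, hv, rfl⟩ := hr
    rcases h.projProd_mul_xMonoid A hu with h₁ | ⟨h₁, w, hw, hwu⟩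
    · exact ⟨1, one_mem _, 0, zero_mem _, by rw [← mul_assoc (h.projProd A), h₁]; simp⟩
    rcases h.yMonoid_mul_projProd A hv with h₂ | h₂
    · exact ⟨1, one_mem _, 0, zero_mem _, by rw [mul_assoc, mul_assoc u, h₂]; simp⟩
    refine ⟨w, hw, v, Submodule.subset_span h₂, ?_⟩
    rw [← mul_assoc (h.projProd A), h₁.eq, mul_assoc u, (h.commute_projProd_yMonoid h₂).eq, mul_assoc,
      mul_assoc v, h.projProd_mul_self, ← mul_assoc, hwu, one_mul]
  | zero => exact ⟨1, one_mem _, 0, zero_mem _, by simp⟩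
  | add a b _ _ ha hb =>
    obtain ⟨w, hw, q, hq, e⟩ := ha
    obtain ⟨w', hw', q', hq', e'⟩ := hb
    refine ⟨w * w', mul_mem hw hw', w' * q + w * q',
      add_mem (mul_mem_span_yMonoid hw' hq) (mul_mem_span_yMonoid hw hq'), ?_⟩
    rw [mul_add, add_mul, mul_add, add_mul, mul_assoc w w' (_ * b * _), e',
      (h.commute_yMonoid hw hw').eq, mul_assoc w' w, e, ← mul_assoc, ← mul_assoc]
  | smul c a _ ha =>
    obtain ⟨w, hw, q, hq, e⟩ := ha
    refine ⟨w, hw, c • q, Submodule.smul_mem _ c hq, ?_⟩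
    rw [mul_smul_comm, smul_mul_assoc, mul_smul_comm, e, smul_mul_assoc]

theorem exists_mul_commutator_eq_zero [DecidableEq ι] (h : OneSidedInverses x y)
    (gen : Algebra.adjoin K (Set.range x ∪ Set.range y) = ⊤) (A : Finset ι) (a b : R) :
    ∃ w ∈ yMonoid y A,
      w * (h.projProd A * a * h.projProd A * (h.projProd A * b * h.projProd A) -
        h.projProd A * b * h.projProd A * (h.projProd A * a * h.projProd A)) = 0 := by
  obtain ⟨w, hw, q, hq, hwq⟩ := h.exists_mul_corner gen A a
  obtain ⟨w', hw', q', hq', hwq'⟩ := h.exists_mul_corner gen A b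
  have key : ∀ {w w' q q' s t : R}, w ∈ yMonoid y A → w' ∈ yMonoid y A →
      q ∈ Submodule.span K (yMonoid y A : Set R) → q' ∈ Submodule.span K (yMonoid y A : Set R) →
      w * s = q * h.projProd A → w' * t = q' * h.projProd A →
      w' * w * (s * t) = q * q' * h.projProd A := by
    intro w w' q q' s t hw hw' hq hq' hs ht
    rw [mul_assoc, ← mul_assoc w, hs, ← mul_assoc, ← mul_assoc,
      (h.commute_span_yMonoid (Submodule.subset_span hw') hq).eq, mul_assoc q w',
      ← (h.commute_projProd_yMonoid hw').eq, ← mul_assoc, mul_assoc _ w' t, ht, mul_assoc q,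
      ← mul_assoc _ q', (h.commute_projProd_span_yMonoid hq').eq, mul_assoc q', h.projProd_mul_self,
      mul_assoc]
  refine ⟨w' * w, mul_mem hw' hw, ?_⟩
  rw [mul_sub, key hw hw' hq hq' hwq hwq', (h.commute_yMonoid hw' hw).eq,
    key hw' hw hq' hq hwq' hwq, (h.commute_span_yMonoid hq hq').eq, sub_self]

theorem exists_mul_pow_eq (h : OneSidedInverses x y)
    (gen : Algebra.adjoin K (Set.range x ∪ Set.range y) = ⊤) (i : ι) (r : R) :
    ∀ k : ℕ, ∃ (N : ℕ) (t : R), r * x i ^ N = x i ^ k * t := by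
  have hr : r ∈ Algebra.adjoin K (Set.range x ∪ Set.range y) := gen ▸ Algebra.mem_top
  induction hr using Algebra.adjoin_induction with
  | mem g hg =>
    intro k
    rcases hg with ⟨j, rfl⟩ | ⟨j, rfl⟩
    · exact ⟨k, x j, ((h.comm_x j i).pow_right k).eq⟩
    · by_cases hij : i = j
      · subst hij
        exact ⟨k + 1, 1, by rw [pow_succ', ← mul_assoc, h.inv, one_mul, mul_one]⟩
      · exact ⟨k, y j, ((h.comm_xy i j hij).symm.pow_right k).eq⟩
  | algebraMap c => exact fun k => ⟨k, algebraMap K R c, Algebra.commutes _ _⟩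
  | add a b _ _ ha hb =>
    intro k
    obtain ⟨N, t, ht⟩ := ha k
    obtain ⟨N', t', ht'⟩ := hb k
    refine ⟨N + N', t * x i ^ N' + t' * x i ^ N, ?_⟩
    rw [add_mul, mul_add, ← mul_assoc, ← mul_assoc, ← ht, ← ht', mul_assoc, mul_assoc, ← pow_add,
      ← pow_add, add_comm N']
  | mul a b _ _ ha hb =>
    intro k
    obtain ⟨N, t, ht⟩ := ha k
    obtain ⟨N', t', ht'⟩ := hb N
    exact ⟨N', t * t', by rw [mul_assoc, ht', ← mul_assoc, ht, mul_assoc]⟩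

theorem exists_projProd_mul_pow_eq_zero [DecidableEq ι] (h : OneSidedInverses x y)
    (gen : Algebra.adjoin K (Set.range x ∪ Set.range y) = ⊤) {A : Finset ι} {i : ι} (hi : i ∈ A)
    (r : R) : ∃ N : ℕ, h.projProd A * r * x i ^ N = 0 := by
  obtain ⟨N, t, ht⟩ := h.exists_mul_pow_eq gen i r 1
  exact ⟨N, by rw [mul_assoc, ht, pow_one, ← mul_assoc, h.projProd_mul_x hi, zero_mul]⟩

theorem mul_mem_of_mul_projProd_mul_mem [DecidableEq ι] (h : OneSidedInverses x y) {I J M : TwoSidedIdeal R}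
    {s : R} (B : Finset ι) (nil : ∀ i ∈ B, ∀ r : R, ∃ N : ℕ, s * r * x i ^ N = 0)
    (H : ∀ a ∈ I, ∀ b ∈ J, s * a * h.projProd B * b ∈ M) :
    ∀ a ∈ I, ∀ b ∈ J, s * a * b ∈ M := by
  induction B using Finset.induction_on with
  | empty => simpa [projProd_empty] using H
  | insert i B hi ih =>
    refine ih (fun j hj => nil j (Finset.mem_insert_of_mem hj)) ?_
    have aux : ∀ (N : ℕ) (a b : R), a ∈ I → b ∈ J → s * a * x i ^ N = 0 →
        s * a * h.projProd B * b ∈ M := by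
      intro N
      induction N with
      | zero =>
        intro a b _ _ h₀
        rw [pow_zero, mul_one] at h₀
        simp [h₀, M.zero_mem]
      | succ N ihN =>
        intro a b ha hb h₀
        have h₁ := ihN (a * x i) (y i * b) (I.mul_mem_right _ _ ha) (J.mul_mem_left _ _ hb)
          (by rw [← h₀, pow_succ']; simp only [mul_assoc])
        have h₂ := H a ha b hb
        convert M.add_mem h₁ h₂ using 1
        rw [h.projProd_insert hi, proj, ← mul_assoc _ (y i), mul_assoc _ _ (y i),
          (h.commute_projProd_y hi).eq]
        noncomm_ring
    intro a ha b hb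
    obtain ⟨N, hN⟩ := nil i (Finset.mem_insert_self i B) a
    exact aux N a b ha hb hN

theorem mem_of_yMonoid_mul_mem [DecidableEq ι] (h : OneSidedInverses x y) {M : TwoSidedIdeal R}
    {A : Finset ι} {w : R} (hw : w ∈ yMonoid y A) :
    ∀ d : R, h.projProd A * d = d → (∀ j ∉ A, ∀ r : R, h.projProd (insert j A) * r * d ∈ M) →
      w * d ∈ M → d ∈ M := by
  induction hw using Submonoid.closure_induction_right with
  | one => simp
  | mul_right w hw _ hy ih =>
    obtain ⟨j, hj, rfl⟩ := hy
    intro d hed hd hwd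
    have h₁ := ih (y j * d) (by rw [← mul_assoc, (h.commute_projProd_y hj).eq, mul_assoc, hed])
      (fun i hi r => by
        rw [← mul_assoc, mul_assoc _ r]
        exact hd i hi _) (by rwa [← mul_assoc])
    have h₂ := hd j hj 1
    rw [h.projProd_insert hj, mul_one, mul_assoc, hed] at h₂
    convert M.add_mem (M.mul_mem_left (x j) _ h₁) h₂ using 1
    rw [proj]
    noncomm_ring

theorem projProd_mul_mem_of_insert [DecidableEq ι] (h : OneSidedInverses x y)
    (gen : Algebra.adjoin K (Set.range x ∪ Set.range y) = ⊤) {I J M : TwoSidedIdeal R}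
    (hM : ∀ a ∈ I, ∀ b ∈ J, b * a ∈ M) (A : Finset ι)
    (ih : ∀ j ∉ A, ∀ a ∈ I, ∀ b ∈ J, h.projProd (insert j A) * a * b ∈ M) :
    ∀ a ∈ I, ∀ b ∈ J, h.projProd A * a * b ∈ M := by
  set e := h.projProd A with he
  have hee : e * e = e := h.projProd_mul_self A
  have corner : ∀ a ∈ I, ∀ b ∈ J, e * a * e * (e * b * e) ∈ M := by
    intro a ha b hb
    obtain ⟨w, hw, hw₀⟩ := h.exists_mul_commutator_eq_zero gen A a b
    have ha' : e * a * e ∈ I := I.mul_mem_right _ _ (I.mul_mem_left _ _ ha)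
    have hb' : e * b * e ∈ J := J.mul_mem_right _ _ (J.mul_mem_left _ _ hb)
    have hba := hM _ ha' _ hb'
    have hd := h.mem_of_yMonoid_mul_mem (M := M) hw _ ?_ ?_ (hw₀ ▸ M.zero_mem)
    · convert M.add_mem hd hba using 1
      rw [← he, sub_add_cancel]
    · rw [← he, mul_sub]
      simp only [← mul_assoc, hee]
    · intro j hj r
      rw [← he, mul_sub]
      refine M.sub_mem ?_ (M.mul_mem_left _ _ hba)
      rw [← mul_assoc, mul_assoc _ r]
      exact ih j hj _ (I.mul_mem_left r _ ha') _ hb'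
  have nil : ∀ s : R, ∀ i ∈ A, ∀ r : R, ∃ N : ℕ, s * e * r * x i ^ N = 0 := by
    intro s i hi r
    obtain ⟨N, hN⟩ := h.exists_projProd_mul_pow_eq_zero gen hi r
    exact ⟨N, by rw [mul_assoc s, mul_assoc s, hN, mul_zero]⟩
  have left_corner : ∀ a ∈ I, ∀ b ∈ J, e * a * e * b ∈ M := by
    intro a ha b hb
    have := h.mul_mem_of_mul_projProd_mul_mem (I := J) (J := ⊤) (M := M) A (nil (e * a))
      (fun b hb c _ => by
        convert M.mul_mem_right _ c (corner a ha b hb) using 1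
        rw [← he]
        simp only [← mul_assoc]
        rw [mul_assoc (e * a) e e, hee]) b hb 1 trivial
    rwa [mul_one] at this
  have := h.mul_mem_of_mul_projProd_mul_mem (M := M) (I := I) (J := J) A (nil 1)
    (fun a ha b hb => by simpa using left_corner a ha b hb)
  simpa using this

theorem mul_mem_of_forall_mul_mem [Fintype ι] (h : OneSidedInverses x y)
    (gen : Algebra.adjoin K (Set.range x ∪ Set.range y) = ⊤) {I J M : TwoSidedIdeal R}
    (hM : ∀ a ∈ I, ∀ b ∈ J, b * a ∈ M) : ∀ a ∈ I, ∀ b ∈ J, a * b ∈ M := by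
  classical
  suffices H : ∀ (m : ℕ) (A : Finset ι), Aᶜ.card = m →
      ∀ a ∈ I, ∀ b ∈ J, h.projProd A * a * b ∈ M by
    simpa [projProd_empty] using H _ ∅ rfl
  intro m
  induction m with
  | zero =>
    intro A hA
    rw [Finset.card_eq_zero, Finset.compl_eq_empty_iff] at hA
    refine h.projProd_mul_mem_of_insert gen hM A fun j hj => ?_
    simp [hA] at hj
  | succ m ih =>
    intro A hA
    refine h.projProd_mul_mem_of_insert gen hM A fun j hj => ih _ ?_
    rw [Finset.compl_insert, Finset.card_erase_of_mem (Finset.mem_compl.mpr hj), hA,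
      Nat.add_sub_cancel]

theorem tsiMul_le [Fintype ι] (h : OneSidedInverses x y)
    (gen : Algebra.adjoin K (Set.range x ∪ Set.range y) = ⊤) (I J : TwoSidedIdeal R) :
    tsiMul I J ≤ tsiMul J I := by
  refine TwoSidedIdeal.span_le.mpr ?_
  rintro _ ⟨a, ha, b, hb, rfl⟩
  exact h.mul_mem_of_forall_mul_mem gen
    (M := tsiMul J I) (fun a ha b hb => TwoSidedIdeal.subset_span ⟨b, hb, a, ha, rfl⟩) a ha b hb

end OneSidedInverses

theorem Xop_monomial (K : Type u) [Field K] (n : ℕ) (i : Fin n) (α : Fin n →₀ ℕ) :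
    Xop K n i (monomial α 1) = monomial (Finsupp.single i 1 + α) 1 := by
  simp [Xop, X, monomial_mul]

theorem Yop_monomial (K : Type u) [Field K] (n : ℕ) (i : Fin n) (α : Fin n →₀ ℕ) :
    Yop K n i (monomial α 1) =
      if α i = 0 then 0 else monomial (α - Finsupp.single i 1) (1 : K) := by
  simpa only [Yop, coe_basisMonomials] using (basisMonomials (Fin n) K).constr_basis K
    (fun α => if α i = 0 then 0 else monomial (α - Finsupp.single i 1) (1 : K)) α

theorem endomorphism_ext {K : Type u} [Field K] {n : ℕ} {f g : Module.End K (PolyAlg K n)}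
    (H : ∀ α, f (monomial α 1) = g (monomial α 1)) : f = g :=
  (basisMonomials (Fin n) K).ext fun α => by simpa using H α

theorem oneSidedInverses_xS_yS (K : Type u) [Field K] (n : ℕ) :
    OneSidedInverses (xS K n) (yS K n) where
  inv i := Subtype.ext <| endomorphism_ext fun α => by
    change Yop K n i (Xop K n i _) = _
    simp [Xop_monomial, Yop_monomial]
  comm_x i j := Subtype.ext <| endomorphism_ext fun α => by
    change Xop K n i (Xop K n j _) = Xop K n j (Xop K n i _)
    rw [Xop_monomial, Xop_monomial, Xop_monomial, Xop_monomial, add_left_comm]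
  comm_y i j := Subtype.ext <| endomorphism_ext fun α => by
    change Yop K n i (Yop K n j _) = Yop K n j (Yop K n i _)
    by_cases hij : i = j
    · rw [hij]
    by_cases hi : α i = 0 <;> by_cases hj : α j = 0 <;>
      simp [Yop_monomial, hi, hj, hij, Ne.symm hij, tsub_right_comm]
  comm_xy i j hij := Subtype.ext <| endomorphism_ext fun α => by
    change Xop K n i (Yop K n j _) = Yop K n j (Xop K n i _)
    by_cases hj : α j = 0
    · simp [Yop_monomial, Xop_monomial, hj, hij]
    · simp only [Yop_monomial, Xop_monomial, hj, hij, if_false, Finsupp.add_apply, ne_eq,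
        not_false_eq_true, Finsupp.single_eq_of_ne', zero_add]
      rw [add_tsub_assoc_of_le]
      simpa using Nat.one_le_iff_ne_zero.mpr hj

theorem adjoin_xS_yS (K : Type u) [Field K] (n : ℕ) :
    Algebra.adjoin K (Set.range (xS K n) ∪ Set.range (yS K n)) = ⊤ := by
  refine Eq.trans ?_ (Algebra.adjoin_adjoin_coe_preimage (R := K)
    (s := Set.range (Xop K n) ∪ Set.range (Yop K n)))
  congr 1
  ext z
  simp only [Set.mem_union, Set.mem_range, Subtype.ext_iff, xS, yS]
  rfl

/-- the two-sided ideals of `S_n` commute: `IJ = JI`. -/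
theorem statement4 (K : Type u) [Field K] (n : ℕ) (hn : 0 < n) :
    ∀ I J : TwoSidedIdeal (SnAlg K n), tsiMul I J = tsiMul J I := by
  have h := oneSidedInverses_xS_yS K n
  have gen := adjoin_xS_yS K n
  exact fun I J => le_antisymm (h.tsiMul_le gen I J) (h.tsiMul_le gen J I)
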